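/- arXiv:1305.4822 — 2 statements merged into one kernel-verified Lean document; each statement's English description precedes it below -/
import Mathlib

section
/- Let k ≥ 1, N ≥ 2k+1, and let λ_1, …, λ_k be real numbers with |λ_i| < 1 for every i. Let D be the diagonal N×N matrix with D_{j,j} = √(Θ_{j,j}), where Θ = Θ^{(diag)}. Then D is invertible and the matrix D · H · D⁻¹ is symmetric, where H = H^{(N)}(λ_1,…,λ_k). -/
open Matrix BigOperators

noncomputable section

/-- `f(x) := (1-x)/(1+x)`. -/
def metricFactor (x : ℝ) : ℝ := (1 - x) / (1 + x)

/-- The discrete square-well Hamiltonian `H^{(N)}(λ₁,…,λ_k)` (indices here are 0-based;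
the 1-based row index of the paper is `i.val + 1`). -/
def Ham (N k : ℕ) (lam : ℕ → ℝ) : Matrix (Fin N) (Fin N) ℝ :=
  Matrix.of fun i j =>
    if i.val = j.val then 2
    else if j.val = i.val + 1 then
      (if i.val + 1 ≤ k then -1 - lam (i.val + 1)
       else if i.val + 1 < N - k then -1
       else -1 + lam (N - (i.val + 1)))
    else if i.val = j.val + 1 then
      (if j.val + 1 ≤ k then -1 + lam (j.val + 1)
       else if j.val + 1 < N - k then -1
       else -1 - lam (N - (j.val + 1)))
    else 0

/-- The `j`-th (1-based) diagonal entry of the diagonal metric `Θ^{(diag)}`. -/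
def thetaEntry (N k : ℕ) (lam : ℕ → ℝ) (j : ℕ) : ℝ :=
  if j ≤ k then ∏ i ∈ Finset.Icc j k, metricFactor (lam i)
  else if j ≤ N - k then 1
  else ∏ i ∈ Finset.Icc (N + 1 - j) k, metricFactor (lam i)

/-- The diagonal matrix `D` with `D_{j,j} = √(Θ_{j,j})`. -/
def sqrtThetaDiag (N k : ℕ) (lam : ℕ → ℝ) : Matrix (Fin N) (Fin N) ℝ :=
  Matrix.diagonal fun i => Real.sqrt (thetaEntry N k lam (i.val + 1))

theorem metricFactor_pos {x : ℝ} (hx : |x| < 1) : 0 < metricFactor x := by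
  obtain ⟨h₁, h₂⟩ := abs_lt.mp hx
  exact div_pos (by linarith) (by linarith)

theorem metricFactor_mul {x : ℝ} (hx : |x| < 1) : metricFactor x * (1 + x) = 1 - x := by
  obtain ⟨h₁, h₂⟩ := abs_lt.mp hx
  exact div_mul_cancel₀ _ (by linarith)

theorem thetaEntry_pos {k N : ℕ} {lam : ℕ → ℝ}
    (hlam : ∀ i, 1 ≤ i → i ≤ k → |lam i| < 1) {j : ℕ} (hj : 1 ≤ j) (hjN : j ≤ N) :
    0 < thetaEntry N k lam j := by
  unfold thetaEntry
  split_ifs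
  · refine Finset.prod_pos fun i hi => ?_
    rw [Finset.mem_Icc] at hi
    exact metricFactor_pos (hlam i (by omega) hi.2)
  · exact one_pos
  · refine Finset.prod_pos fun i hi => ?_
    rw [Finset.mem_Icc] at hi
    exact metricFactor_pos (hlam i (by omega) hi.2)

theorem thetaEntry_of_le {k N : ℕ} (lam : ℕ → ℝ) {j : ℕ} (hj : j ≤ N - k) :
    thetaEntry N k lam j = ∏ i ∈ Finset.Icc j k, metricFactor (lam i) := by
  unfold thetaEntry
  split_ifs
  · rfl
  · rw [Finset.Icc_eq_empty (by omega), Finset.prod_empty]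

theorem thetaEntry_of_lt {k N : ℕ} (lam : ℕ → ℝ) {j : ℕ} (hj : k < j) :
    thetaEntry N k lam j = ∏ i ∈ Finset.Icc (N + 1 - j) k, metricFactor (lam i) := by
  unfold thetaEntry
  split_ifs
  · omega
  · rw [Finset.Icc_eq_empty (by omega), Finset.prod_empty]
  · rfl

theorem prod_Icc_eq_mul_prod_succ (f : ℕ → ℝ) {a b : ℕ} (hab : a ≤ b) :
    ∏ i ∈ Finset.Icc a b, f i = f a * ∏ i ∈ Finset.Icc (a + 1) b, f i := by
  rw [← Finset.insert_Icc_add_one_left_eq_Icc hab, Finset.prod_insert (by simp)]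

theorem thetaEntry_mul_Ham_of_succ {k N : ℕ} (hN : 2 * k + 1 ≤ N) {lam : ℕ → ℝ}
    (hlam : ∀ i, 1 ≤ i → i ≤ k → |lam i| < 1) {i j : Fin N} (hij : j.val = i.val + 1) :
    thetaEntry N k lam (i.val + 1) * Ham N k lam i j =
      thetaEntry N k lam (j.val + 1) * Ham N k lam j i := by
  have hj := j.isLt
  simp only [Ham, Matrix.of_apply]
  rw [if_neg (show ¬i.val = j.val by omega), if_pos hij, if_neg (show ¬j.val = i.val by omega),
    if_neg (show ¬i.val = j.val + 1 by omega), if_pos hij, hij]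
  split_ifs with h₁ h₂
  · rw [thetaEntry_of_le lam (by omega), thetaEntry_of_le lam (by omega),
      prod_Icc_eq_mul_prod_succ _ h₁]
    linear_combination (-∏ l ∈ Finset.Icc (i.val + 1 + 1) k, metricFactor (lam l)) *
      metricFactor_mul (hlam (i.val + 1) (by omega) h₁)
  · rw [thetaEntry_of_le lam (by omega), thetaEntry_of_le lam (by omega),
      Finset.Icc_eq_empty (by omega), Finset.Icc_eq_empty (by omega)]
  · rw [thetaEntry_of_lt lam (by omega), thetaEntry_of_lt lam (by omega),
      show N + 1 - (i.val + 1 + 1) = N - (i.val + 1) by omega,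
      show N + 1 - (i.val + 1) = N - (i.val + 1) + 1 by omega,
      prod_Icc_eq_mul_prod_succ _ (show N - (i.val + 1) ≤ k by omega)]
    linear_combination (∏ l ∈ Finset.Icc (N - (i.val + 1) + 1) k, metricFactor (lam l)) *
      metricFactor_mul (hlam (N - (i.val + 1)) (by omega) (by omega))

theorem thetaEntry_mul_Ham {k N : ℕ} (hN : 2 * k + 1 ≤ N) {lam : ℕ → ℝ}
    (hlam : ∀ i, 1 ≤ i → i ≤ k → |lam i| < 1) (i j : Fin N) :
    thetaEntry N k lam (i.val + 1) * Ham N k lam i j =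
      thetaEntry N k lam (j.val + 1) * Ham N k lam j i := by
  by_cases hij : j.val = i.val + 1
  · exact thetaEntry_mul_Ham_of_succ hN hlam hij
  by_cases hji : i.val = j.val + 1
  · exact (thetaEntry_mul_Ham_of_succ hN hlam hji).symm
  by_cases h : i = j
  · rw [h]
  · have h' : i.val ≠ j.val := fun e => h (Fin.ext e)
    simp [Ham, hij, hji, h', h'.symm]

/-- If `diagonal d ^ 2` intertwines `A` with its transpose, conjugating `A` by `diagonal d` gives
a symmetric matrix. -/
theorem isSymm_diagonal_mul_mul_inv {n : Type*} [Fintype n] [DecidableEq n] {d : n → ℝ}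
    (hd : ∀ i, d i ≠ 0) {A : Matrix n n ℝ} (hA : ∀ i j, d i ^ 2 * A i j = d j ^ 2 * A j i) :
    (Matrix.diagonal d * A * (Matrix.diagonal d)⁻¹).IsSymm := by
  have hinv : (Matrix.diagonal d)⁻¹ = Matrix.diagonal fun i => (d i)⁻¹ := by
    refine Matrix.inv_eq_right_inv ?_
    rw [Matrix.diagonal_mul_diagonal, ← Matrix.diagonal_one]
    exact congrArg _ (funext fun i => mul_inv_cancel₀ (hd i))
  rw [hinv]
  refine Matrix.IsSymm.ext fun i j => ?_
  rw [Matrix.mul_diagonal, Matrix.diagonal_mul, Matrix.mul_diagonal, Matrix.diagonal_mul,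
    ← div_eq_mul_inv, ← div_eq_mul_inv, div_eq_div_iff (hd i) (hd j)]
  linear_combination hA j i

/-- for `k ≥ 1`, `N ≥ 2k+1`, `|λᵢ| < 1`, the diagonal matrix
`D = √Θ` is invertible and `D ⬝ H ⬝ D⁻¹` is a symmetric matrix. -/
theorem sqrt_metric_symmetrizes (k N : ℕ) (hk : 1 ≤ k) (hN : 2 * k + 1 ≤ N)
    (lam : ℕ → ℝ) (hlam : ∀ i, 1 ≤ i → i ≤ k → |lam i| < 1) :
    IsUnit (sqrtThetaDiag N k lam) ∧
      (sqrtThetaDiag N k lam * Ham N k lam * (sqrtThetaDiag N k lam)⁻¹).IsSymm := by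
  have hpos (i : Fin N) : 0 < thetaEntry N k lam (i.val + 1) :=
    thetaEntry_pos hlam (by omega) (by omega)
  have hne (i : Fin N) : √(thetaEntry N k lam (i.val + 1)) ≠ 0 := (Real.sqrt_pos.mpr (hpos i)).ne'
  refine ⟨?_, isSymm_diagonal_mul_mul_inv hne fun i j => ?_⟩
  · exact Matrix.isUnit_diagonal.mpr (Pi.isUnit_iff.mpr fun i => (hne i).isUnit)
  · rw [Real.sq_sqrt (hpos i).le, Real.sq_sqrt (hpos j).le]
    exact thetaEntry_mul_Ham hN hlam i j
end
end

section
/- For t = 1 and for t = −1, the secular polynomial of H^{(11)}(t,−t,t,−t), i.e. the characteristic polynomial det(E·I − (H − 2I)) of the shifted matrix H − 2I, degenerates to E^{11} − 2E⁹ = E⁹·(E² − 2); consequently, at these two exceptional-point parameter values the shifted Hamiltonian H − 2I has the eigenvalue 0 with algebraic multiplicity 9 and the two simple eigenvalues ±√2. -/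
open Matrix Polynomial

noncomputable section

/-- The 11×11 Hamiltonian `H^{(11)}(t,−t,t,−t)` is `H11 t t t t` below (0-based indices). -/
def H11 (l m n r : ℝ) : Matrix (Fin 11) (Fin 11) ℝ :=
  Matrix.of fun i j =>
    if i = j then 2
    else if h : j.val = i.val + 1 then
      ![-1-l, -1+m, -1-n, -1+r, -1, -1, -1-r, -1+n, -1-m, -1+l]
        ⟨i.val, by have := j.isLt; omega⟩
    else if h' : i.val = j.val + 1 then
      ![-1+l, -1-m, -1+n, -1-r, -1, -1, -1+r, -1-n, -1+m, -1-l]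
        ⟨j.val, by have := i.isLt; omega⟩
    else 0

/-- The tridiagonal matrix with diagonal `a`, superdiagonal `b` and subdiagonal `c`. -/
def tridiagonal {R : Type*} [Zero R] (a b c : ℕ → R) (n : ℕ) : Matrix (Fin n) (Fin n) R :=
  Matrix.of fun i j =>
    if i.val = j.val then a i.val
    else if j.val = i.val + 1 then b i.val
    else if i.val = j.val + 1 then c j.val
    else 0

/-- The three-term recurrence for the determinant of a tridiagonal matrix. -/
theorem det_tridiagonal_add_two {R : Type*} [CommRing R] (a b c : ℕ → R) (n : ℕ) :
    (tridiagonal a b c (n + 2)).det =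
      a 0 * (tridiagonal (fun k => a (k + 1)) (fun k => b (k + 1)) (fun k => c (k + 1))
        (n + 1)).det -
      b 0 * c 0 * (tridiagonal (fun k => a (k + 2)) (fun k => b (k + 2)) (fun k => c (k + 2))
        n).det := by
  have h₀ : (tridiagonal a b c (n + 2)).submatrix Fin.succ (Fin.succAbove 0) =
      tridiagonal (fun k => a (k + 1)) (fun k => b (k + 1)) (fun k => c (k + 1)) (n + 1) := by
    ext i j
    simp [tridiagonal]
  have h₁ : ((tridiagonal a b c (n + 2)).submatrix Fin.succ (Fin.succAbove 1)).det =
      c 0 * (tridiagonal (fun k => a (k + 2)) (fun k => b (k + 2)) (fun k => c (k + 2))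
        n).det := by
    rw [det_succ_column_zero, Fin.sum_univ_succ, Finset.sum_eq_zero, add_zero]
    · have h₂ : ((tridiagonal a b c (n + 2)).submatrix Fin.succ (Fin.succAbove 1)).submatrix
          (Fin.succAbove 0) Fin.succ =
          tridiagonal (fun k => a (k + 2)) (fun k => b (k + 2)) (fun k => c (k + 2)) n := by
        ext i j
        simp [tridiagonal]
      rw [h₂]
      simp [tridiagonal]
    · intro i _
      simp [tridiagonal]
  rw [det_succ_row_zero, Fin.sum_univ_succ, Fin.sum_univ_succ, Finset.sum_eq_zero, add_zero,
    h₀, Fin.succ_zero_eq_one, h₁]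
  · simp [tridiagonal]
    ring
  · intro i _
    simp [tridiagonal]

theorem charmatrix_H11_sub_two (t : ℝ) :
    charmatrix (H11 t t t t - 2) =
      tridiagonal (fun _ => X)
        (fun k => if k = 4 ∨ k = 5 then 1 else if Even k then C (1 + t) else C (1 - t))
        (fun k => if k = 4 ∨ k = 5 then 1 else if Even k then C (1 - t) else C (1 + t)) 11 := by
  have h2 : (2 : Matrix (Fin 11) (Fin 11) ℝ) = diagonal fun _ => 2 := rfl
  ext1 i j
  rw [charmatrix_apply, h2]
  by_cases hij : i = j
  · subst hij
    simp [H11, tridiagonal]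
  · have hv : i.val ≠ j.val := fun h => hij (Fin.ext h)
    simp only [H11, tridiagonal, Matrix.sub_apply, of_apply, diagonal_apply_ne _ hij, hij, hv,
      if_false, sub_zero]
    obtain ⟨i, hi⟩ := i
    obtain ⟨j, hj⟩ := j
    dsimp only at hv ⊢
    by_cases h : j = i + 1
    · subst h
      replace hi : i < 10 := by omega
      interval_cases i <;> simp [Nat.even_iff] <;> ring
    · by_cases h' : i = j + 1
      · subst h'
        replace hj : j < 10 := by omega
        interval_cases j <;> simp [Nat.even_iff] <;> ring
      · simp [h, h']

theorem det_tridiagonal_zero {R : Type*} [CommRing R] (a b c : ℕ → R) :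
    (tridiagonal a b c 0).det = 1 :=
  det_isEmpty

theorem det_tridiagonal_one {R : Type*} [CommRing R] (a b c : ℕ → R) :
    (tridiagonal a b c 1).det = a 0 := by
  simp [tridiagonal]

/-- If all off-diagonal products vanish except the two middle ones, which equal `1`, the determinant
of the tridiagonal matrix of size `11` with constant diagonal `x` is `x ^ 11 - 2 * x ^ 9`. -/
theorem det_tridiagonal_eleven {R : Type*} [CommRing R] (x : R) (b c : ℕ → R)
    (h : ∀ k, k ≠ 4 → k ≠ 5 → b k * c k = 0)
    (h₄ : b 4 * c 4 = 1) (h₅ : b 5 * c 5 = 1) :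
    (tridiagonal (fun _ => x) b c 11).det = x ^ 11 - 2 * x ^ 9 := by
  simp only [det_tridiagonal_add_two, det_tridiagonal_zero, det_tridiagonal_one, Nat.reduceAdd,
    h₄, h₅, h 0, h 1, h 2, h 3, h 6, h 7, h 8, h 9, ne_eq, Nat.reduceEqDiff,
    OfNat.zero_ne_ofNat, OfNat.one_ne_ofNat, not_false_eq_true]
  ring

theorem charpoly_H11_sub_two (t : ℝ) (ht : t = 1 ∨ t = -1) :
    (H11 t t t t - 2).charpoly = X ^ 11 - C (2 : ℝ) * X ^ 9 := by
  rw [charpoly, charmatrix_H11_sub_two, det_tridiagonal_eleven]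
  · rfl
  · intro k h₄ h₅
    rcases ht with rfl | rfl <;> by_cases hk : Even k <;> simp [h₄, h₅, hk]
  · simp
  · simp

theorem rootMultiplicity_of_eq_mul {p q : ℝ[X]} {a : ℝ} {n : ℕ}
    (h : p = (X - C a) ^ n * q) (hq : q.eval a ≠ 0) : p.rootMultiplicity a = n := by
  have hq0 : q ≠ 0 := by
    rintro rfl
    simp at hq
  rw [h, rootMultiplicity_mul (mul_ne_zero (pow_ne_zero _ (X_sub_C_ne_zero a)) hq0),
    rootMultiplicity_X_sub_C_pow, rootMultiplicity_eq_zero hq, add_zero]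

/-- for `t = 1` and for `t = −1` the secular polynomial
`det(E·I − (H − 2I))` of `H = H^{(11)}(t,−t,t,−t)` degenerates to
`E^11 − 2E⁹ = E⁹(E² − 2)`; consequently the shifted Hamiltonian `H − 2I` has the
eigenvalue `0` with algebraic multiplicity `9` and the two simple eigenvalues `±√2`. -/
theorem secular_polynomial_EP (t : ℝ) (ht : t = 1 ∨ t = -1) :
    (H11 t t t t - 2).charpoly = X ^ 11 - C (2 : ℝ) * X ^ 9 ∧
    (X ^ 11 - C (2 : ℝ) * X ^ 9 : ℝ[X]) = X ^ 9 * (X ^ 2 - C 2) ∧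
    ((H11 t t t t - 2).charpoly).rootMultiplicity 0 = 9 ∧
    ((H11 t t t t - 2).charpoly).rootMultiplicity (Real.sqrt 2) = 1 ∧
    ((H11 t t t t - 2).charpoly).rootMultiplicity (-Real.sqrt 2) = 1 := by
  have hfac : (X ^ 11 - C (2 : ℝ) * X ^ 9 : ℝ[X]) = X ^ 9 * (X ^ 2 - C 2) := by ring
  have hs : (C (2 : ℝ) : ℝ[X]) = C (Real.sqrt 2) ^ 2 := by
    rw [← C_pow, Real.sq_sqrt zero_le_two]
  have hpos : Real.sqrt 2 ≠ 0 := by positivity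
  rw [charpoly_H11_sub_two t ht]
  refine ⟨rfl, hfac, ?_, ?_, ?_⟩
  · refine rootMultiplicity_of_eq_mul (q := X ^ 2 - C 2) ?_ (by simp)
    rw [hfac, C_0, sub_zero]
  · refine rootMultiplicity_of_eq_mul (q := X ^ 9 * (X + C (Real.sqrt 2))) ?_ ?_
    · rw [hs]
      ring
    · simp [← two_mul]
  · refine rootMultiplicity_of_eq_mul (q := X ^ 9 * (X - C (Real.sqrt 2))) ?_ ?_
    · rw [hs, C_neg]
      ring
    · simp [← neg_add', ← two_mul]
end
end
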